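/- Let n ≥ 1 and let (Ψ_π)_{π∈NC_n} be a family of wheel polynomials of order n satisfying Ψ_π(σ) = 1 if σ = π and Ψ_π(σ) = 0 if σ ≠ π, for all σ ∈ NC_n. Then the vector ψ = (ψ_π)_{π∈NC_n} defined by ψ_π = Ψ_π(1,1,…,1) satisfies the stationarity system: 2n·ψ_π = Σ_{k=1}^{2n} Σ_{π'∈NC_n with e_k(π')=π} ψ_{π'} for every π ∈ NC_n. -/

import Mathlib

open scoped BigOperators

open MvPolynomial

attribute [local instance 10] Classical.propDecidable

/-- A noncrossing matching of order `n`, on the points `0, …, 2n-1`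
(representing the 1-indexed points `1, …, 2n`): a fixed-point-free involution
with no crossing `a < b < c < d`, `f a = c`, `f b = d`. -/
structure NCM (n : ℕ) where
  f : Fin (2 * n) → Fin (2 * n)
  invol : ∀ k, f (f k) = k
  nofix : ∀ k, f k ≠ k
  noncross : ∀ a b c d : Fin (2 * n), a < b → b < c → c < d → f a = c → f b = d → False

theorem NCM.ext' {n : ℕ} {π σ : NCM n} (h : π.f = σ.f) : π = σ := by
  cases π; cases σ; simpa using h

noncomputable instance {n : ℕ} : Fintype (NCM n) :=
  Fintype.ofInjective NCM.f fun _ _ h => NCM.ext' h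

/-- `q = e^{2πi/3}`. -/
noncomputable def q : ℂ := Complex.exp (2 * Real.pi * Complex.I / 3)

/-- A wheel polynomial of order `n`: homogeneous of total degree `n(n-1)` and
vanishing under every substitution `z_j := q² z_i`, `z_k := q⁴ z_i` for `i < j < k`. -/
def IsWheel (n : ℕ) (p : MvPolynomial (Fin (2 * n)) ℂ) : Prop :=
  p.IsHomogeneous (n * (n - 1)) ∧
  ∀ i j k : Fin (2 * n), i < j → j < k →
    (aeval fun l : Fin (2 * n) =>
      if l = j then C (q ^ 2) * X i
      else if l = k then C (q ^ 4) * X i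
      else (X l : MvPolynomial (Fin (2 * n)) ℂ)) p = 0

/-- The `π`-evaluation `p(π) = p(q^{-π_1}, …, q^{-π_{2n}})`, where the `k`-th coordinate
is `q⁻¹` if `π` matches `k` to the right and `q` if it matches `k` to the left. -/
noncomputable def evalNC {n : ℕ} (p : MvPolynomial (Fin (2 * n)) ℂ) (π : NCM n) : ℂ :=
  eval (fun k => if k < π.f k then q⁻¹ else q) p

/-- Evaluation of a polynomial with all variables set to `1`. -/
noncomputable def evalOne {n : ℕ} (p : MvPolynomial (Fin (2 * n)) ℂ) : ℂ :=
  eval (fun _ => (1 : ℂ)) p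

/-- The alternating sign matrix numbers `ASM(n) = ∏_{j=0}^{n-1} (3j+1)!/(n+j)!`. -/
noncomputable def ASM (n : ℕ) : ℂ :=
  ∏ j ∈ Finset.range n, ((3 * j + 1).factorial : ℂ) / ((n + j).factorial : ℂ)

/-- Cyclic successor on `Fin m`. -/
def fsucc {m : ℕ} (k : Fin m) : Fin m := ⟨((k : ℕ) + 1) % m, Nat.mod_lt _ k.pos⟩

/-- The Temperley–Lieb operator `e_k` (underlying function on points): if `π` matches
`k` with `k+1` it is `π`; otherwise it matches `k ↔ k+1`, `π(k) ↔ π(k+1)` and agrees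
with `π` elsewhere (indices cyclic modulo `2n`). -/
def eRaw {n : ℕ} (k : Fin (2 * n)) (π : NCM n) : Fin (2 * n) → Fin (2 * n) :=
  if π.f k = fsucc k then π.f
  else fun m =>
    if m = k then fsucc k
    else if m = fsucc k then k
    else if m = π.f k then π.f (fsucc k)
    else if m = π.f (fsucc k) then π.f k
    else π.f m

/-- The stationarity linear system `2n·v_π = Σ_{k=1}^{2n} Σ_{π' : e_k(π') = π} v_{π'}`. -/
def Stationary {n : ℕ} (v : NCM n → ℂ) : Prop :=
  ∀ π : NCM n, ((2 * n : ℕ) : ℂ) * v π =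
    ∑ k : Fin (2 * n), ∑ π' : NCM n, if eRaw k π' = π.f then v π' else 0


theorem q_cube : q ^ 3 = 1 := by
  have h := Complex.isPrimitiveRoot_exp 3 (by norm_num)
  have := h.pow_eq_one
  simpa [q] using this

theorem q_ne_one : q ≠ 1 := by
  have h := Complex.isPrimitiveRoot_exp 3 (by norm_num)
  have := h.ne_one (by norm_num)
  simpa [q] using this

theorem q_ne_zero : q ≠ 0 := Complex.exp_ne_zero _

theorem q_inv : q⁻¹ = q ^ 2 := by
  have := q_cube
  have := q_ne_zero
  field_simp
  linear_combination -q_cube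

theorem q_four : q ^ 4 = q := by linear_combination q * q_cube

theorem q_sq_ne_one : q ^ 2 ≠ 1 := by
  intro h
  apply q_ne_one
  linear_combination q_cube - q * h

theorem q_sq_ne : q ^ 2 ≠ q := by
  intro h
  apply q_ne_one
  linear_combination q_cube - (q + 1) * h

theorem lin_dvd_sub {I : Type} [DecidableEq I] (i : I) (L p : MvPolynomial I ℂ) :
    X i - L ∣ p - aeval (Function.update X i L) p := by
  induction p using MvPolynomial.induction_on with
  | C a => simp
  | add p r hp hr =>
    have := dvd_add hp hr
    rw [map_add]
    convert this using 1
    ring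
  | mul_X p k hp =>
    rw [map_mul, aeval_X]
    by_cases hk : k = i
    · subst hk
      rw [Function.update_self]
      have h2 : X k - L ∣ p * (X k - L) := Dvd.intro_left _ rfl
      convert dvd_add h2 (hp.mul_right L) using 1
      ring
    · rw [Function.update_of_ne hk]
      convert hp.mul_right (X k) using 1
      ring

theorem lin_dvd_iff {I : Type} [DecidableEq I] (i : I) (L p : MvPolynomial I ℂ)
    (hL : aeval (Function.update X i L) L = L) :
    X i - L ∣ p ↔ aeval (Function.update X i L) p = 0 := by
  constructor
  · rintro ⟨r, rfl⟩
    rw [map_mul, map_sub, hL, aeval_X, Function.update_self, sub_self, zero_mul]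
  · intro h
    have := lin_dvd_sub i L p
    rwa [h, sub_zero] at this

theorem eval_aeval_fun {I J : Type} (z : J → ℂ) (g : I → MvPolynomial J ℂ)
    (p : MvPolynomial I ℂ) : eval z (aeval g p) = eval (fun k => eval z (g k)) p := by
  induction p using MvPolynomial.induction_on with
  | C a => simp
  | add p r hp hr => rw [map_add, map_add, map_add, hp, hr]
  | mul_X p k hp => rw [map_mul, map_mul, map_mul, hp, aeval_X, eval_X]

theorem lin_dvd_iff_eval {I : Type} [DecidableEq I] (i : I) (L p : MvPolynomial I ℂ)
    (hL : aeval (Function.update X i L) L = L) :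
    X i - L ∣ p ↔ ∀ z : I → ℂ, z i = eval z L → eval z p = 0 := by
  constructor
  · rintro ⟨r, rfl⟩ z hz
    simp [hz]
  · intro h
    rw [lin_dvd_iff i L p hL]
    apply MvPolynomial.funext
    intro z
    rw [eval_aeval_fun, map_zero]
    apply h
    rw [← eval_aeval_fun, hL]
    simp

theorem lin_prime {I : Type} [DecidableEq I] (i : I) (L : MvPolynomial I ℂ)
    (hL : aeval (Function.update X i L) L = L) (hne : X i - L ≠ 0) :
    Prime (X i - L) := by
  refine ⟨hne, ?_, ?_⟩
  · intro hu
    have : X i - L ∣ 1 := hu.dvd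
    rw [lin_dvd_iff i L _ hL] at this
    simp at this
  · intro a b hab
    rw [lin_dvd_iff i L _ hL] at hab ⊢
    rw [lin_dvd_iff i L _ hL]
    rw [map_mul] at hab
    exact mul_eq_zero.mp hab

theorem prime_deg {I : Type} {l : MvPolynomial I ℂ} (h : Prime l) : 1 ≤ l.totalDegree := by
  by_contra hlt
  have h0 : l.totalDegree = 0 := by omega
  rw [totalDegree_eq_zero_iff_eq_C] at h0
  have hc : coeff 0 l ≠ 0 := by
    intro hc
    rw [hc, C_0] at h0
    exact h.ne_zero h0
  apply h.not_isUnit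
  rw [h0]
  exact (IsUnit.mk0 _ hc).map C

theorem prod_factor {I τ : Type} (T : Finset τ) (l : τ → MvPolynomial I ℂ)
    (hp : ∀ t ∈ T, Prime (l t)) (hnd : ∀ t ∈ T, ∀ s ∈ T, t ≠ s → ¬ l t ∣ l s)
    (p : MvPolynomial I ℂ) (h0 : p ≠ 0) (hd : ∀ t ∈ T, l t ∣ p) :
    ∃ r, p = (∏ t ∈ T, l t) * r ∧ r.totalDegree + T.card ≤ p.totalDegree := by
  induction T using Finset.induction_on with
  | empty => exact ⟨p, by simp, by simp⟩
  | insert t T ht ih =>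
    obtain ⟨r, hr, hdeg⟩ := ih (fun s hs => hp s (Finset.mem_insert_of_mem hs))
      (fun s hs s' hs' => hnd s (Finset.mem_insert_of_mem hs) s' (Finset.mem_insert_of_mem hs'))
      (fun s hs => hd s (Finset.mem_insert_of_mem hs))
    have htp := hp t (Finset.mem_insert_self _ _)
    have h1 := hd t (Finset.mem_insert_self _ _)
    rw [hr] at h1
    rcases htp.dvd_or_dvd h1 with h2 | h2
    · rw [htp.dvd_finsetProd_iff] at h2
      obtain ⟨s, hs, hts⟩ := h2
      exact absurd hts (hnd t (Finset.mem_insert_self _ _) s (Finset.mem_insert_of_mem hs)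
        (fun h => ht (h ▸ hs)))
    · obtain ⟨r', rfl⟩ := h2
      refine ⟨r', ?_, ?_⟩
      · rw [Finset.prod_insert ht, hr]; ring
      · have hr0 : r' ≠ 0 := by
          rintro rfl
          apply h0; rw [hr]; simp
        rw [totalDegree_mul_of_isDomain htp.ne_zero hr0] at hdeg
        rw [Finset.card_insert_of_notMem ht]
        have := prime_deg htp
        omega

theorem line_poly {I : Type} (p : MvPolynomial I ℂ) (z v : I → ℂ) :
    ∃ f : Polynomial ℂ, ∀ t, f.eval t = eval (fun l => z l + t * v l) p := by
  refine ⟨aeval (fun l => Polynomial.C (z l) + Polynomial.X * Polynomial.C (v l)) p, ?_⟩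
  intro t
  induction p using MvPolynomial.induction_on with
  | C a => simp
  | add p r hp hr => rw [map_add, map_add, Polynomial.eval_add, hp, hr]
  | mul_X p k hp =>
    rw [map_mul, map_mul, Polynomial.eval_mul, hp, aeval_X, eval_X]
    simp only [Polynomial.eval_add, Polynomial.eval_mul, Polynomial.eval_C, Polynomial.eval_X]

/-- If `g(t) * p(z + t v) = 0` for all `t` with `g` a nonzero polynomial then `p (z + t v) = 0`. -/
theorem line_zero {I : Type} (p g : MvPolynomial I ℂ) (z v : I → ℂ)
    (t0 : ℂ) (ht0 : eval (fun l => z l + t0 * v l) g ≠ 0)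
    (h : ∀ t : ℂ, eval (fun l => z l + t * v l) g * eval (fun l => z l + t * v l) p = 0) (t : ℂ) :
    eval (fun l => z l + t * v l) p = 0 := by
  obtain ⟨f, hf⟩ := line_poly p z v
  obtain ⟨f', hf'⟩ := line_poly g z v
  have h1 : f' * f = 0 := by
    apply Polynomial.funext
    intro s
    rw [Polynomial.eval_mul, hf, hf', h, Polynomial.eval_zero]
  rcases mul_eq_zero.mp h1 with h2 | h2
  · rw [← hf', h2] at ht0
    simp at ht0
  · rw [← hf, h2, Polynomial.eval_zero]

theorem totalDegree_subst_le {I J : Type} (g : I → MvPolynomial J ℂ)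
    (hg : ∀ i, (g i).totalDegree ≤ 1) (p : MvPolynomial I ℂ) :
    (aeval g p).totalDegree ≤ p.totalDegree := by
  rw [aeval_def, eval₂_eq]
  apply totalDegree_finsetSum_le
  intro d hd
  refine (totalDegree_mul _ _).trans ?_
  have h1 : (algebraMap ℂ (MvPolynomial J ℂ) (coeff d p)).totalDegree = 0 := by
    rw [algebraMap_eq]; exact totalDegree_C _
  rw [h1, zero_add]
  refine (totalDegree_finsetProd _ _).trans ?_
  refine le_trans ?_ (le_totalDegree hd)
  rw [Finsupp.sum]
  apply Finset.sum_le_sum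
  intro i _
  refine (totalDegree_pow _ _).trans ?_
  simpa using Nat.mul_le_mul_left (d i) (hg i)


/-- Wheel condition with respect to the order given by a rank function. -/
def WH {I : Type} (ρ : I → ℕ) (p : MvPolynomial I ℂ) : Prop :=
  ∀ i j k, ρ i < ρ j → ρ j < ρ k → ∀ z : I → ℂ, z j = q ^ 2 * z i → z k = q ^ 4 * z i →
    eval z p = 0

theorem WH.cyc {I : Type} {ρ ρ' : I → ℕ} {p : MvPolynomial I ℂ} (h : WH ρ p)
    (hc : ∀ i j k, ρ' i < ρ' j → ρ' j < ρ' k →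
      (ρ i < ρ j ∧ ρ j < ρ k) ∨ (ρ j < ρ k ∧ ρ k < ρ i) ∨ (ρ k < ρ i ∧ ρ i < ρ j)) :
    WH ρ' p := by
  intro i j k hij hjk z h1 h2
  rcases hc i j k hij hjk with ⟨a, b⟩ | ⟨a, b⟩ | ⟨a, b⟩
  · exact h i j k a b z h1 h2
  · refine h j k i a b z ?_ ?_
    · rw [h2, h1]; ring
    · rw [h1]; linear_combination (-(q ^ 3 + 1) * z i) * q_cube
  · refine h k i j a b z ?_ ?_
    · rw [h2]; linear_combination (-(q ^ 3 + 1) * z i) * q_cube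
    · rw [h2, h1]; linear_combination (-(q ^ 5 + q ^ 2) * z i) * q_cube

theorem lin_const_prime {I : Type} (l : I) (c : ℂ) : Prime (X l - C c : MvPolynomial I ℂ) := by
  apply lin_prime
  · simp
  · intro h
    have := congrArg (eval (fun _ => c + 1)) h
    simp at this

theorem red {I : Type} (ρ : I → ℕ) (p : MvPolynomial I ℂ) (hW : WH ρ p) (i j : I)
    (hij : i ≠ j) (w : ℂ) (T : Finset ({l : I // l ≠ i ∧ l ≠ j} × ℂ)) (hc : ∀ t ∈ T, t.2 ≠ 0)
    (hv : ∀ t ∈ T, ∀ z : I → ℂ, z i = w → z j = q ^ 2 * w → z t.1 = t.2 → eval z p = 0) :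
    ∃ r : MvPolynomial {l : I // l ≠ i ∧ l ≠ j} ℂ, WH (fun l => ρ l.1) r ∧
      (r = 0 ∨ r.totalDegree + T.card ≤ p.totalDegree) ∧
      ∀ z : I → ℂ, z i = w → z j = q ^ 2 * w →
        eval z p = (∏ t ∈ T, (z t.1 - t.2)) * eval (fun l => z l.1) r := by
  set g : I → MvPolynomial {l : I // l ≠ i ∧ l ≠ j} ℂ := fun l =>
    if h : l ≠ i ∧ l ≠ j then X ⟨l, h⟩ else if l = i then C w else C (q ^ 2 * w) with hg
  have hev : ∀ z : I → ℂ, z i = w → z j = q ^ 2 * w →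
      eval (fun l : {l : I // l ≠ i ∧ l ≠ j} => z l.1) (aeval g p) = eval z p := by
    intro z hi hj
    rw [eval_aeval_fun]
    congr 2
    funext l
    by_cases h : l ≠ i ∧ l ≠ j
    · simp [hg, h]
    · by_cases h' : l = i
      · simp [hg, h', hi]
      · have : l = j := by tauto
        subst this
        simp [hg, h', hj]
  have hext : ∀ z : {l : I // l ≠ i ∧ l ≠ j} → ℂ, ∃ z' : I → ℂ, z' i = w ∧ z' j = q ^ 2 * w ∧
      (fun l : {l : I // l ≠ i ∧ l ≠ j} => z' l.1) = z := by
    intro z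
    refine ⟨fun l => if h : l ≠ i ∧ l ≠ j then z ⟨l, h⟩ else if l = i then w else q ^ 2 * w,
      by simp, by simp [hij.symm], ?_⟩
    funext l
    simp [l.2.1, l.2.2]
  by_cases h0 : aeval g p = 0
  · refine ⟨0, fun _ _ _ _ _ _ _ _ => by simp, Or.inl rfl, ?_⟩
    intro z hi hj
    rw [← hev z hi hj, h0]
    simp
  obtain ⟨r, hr, hdeg⟩ := prod_factor T
    (fun t => (X t.1 - C t.2 : MvPolynomial {l : I // l ≠ i ∧ l ≠ j} ℂ))
    (fun t _ => lin_const_prime _ _) (by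
      intro t _ s _ hts hd
      rw [lin_dvd_iff_eval _ _ _ (by simp)] at hd
      by_cases h1 : s.1 = t.1
      · have h2 : s.2 ≠ t.2 := fun h => hts (Prod.ext h1 h).symm
        have := hd (fun _ => t.2) (by simp)
        simp at this
        exact h2 (by linear_combination -this)
      · have h1' : ¬ t.1 = s.1 := fun h => h1 h.symm
        have := hd (fun l => if l = s.1 then s.2 + 1 else t.2) (by simp [h1'])
        simp at this)
    _ h0 (by
      intro t ht
      rw [lin_dvd_iff_eval _ _ _ (by simp)]
      intro z hz
      obtain ⟨z', h1, h2, h3⟩ := hext z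
      rw [← h3, hev z' h1 h2]
      apply hv t ht z' h1 h2
      simp at hz
      rw [← hz, ← h3])
  refine ⟨r, ?_, Or.inr ?_, ?_⟩
  · intro a b c hab hbc z h1 h2
    have := line_zero r (∏ t ∈ T, (X t.1 - C t.2)) (fun _ => 0) z 0 (by
      simp [Finset.prod_eq_zero_iff]
      intro a ha h b
      exact hc _ b rfl) (by
      intro t
      rw [← map_mul, ← hr]
      obtain ⟨z', h1', h2', h3'⟩ := hext (fun l => 0 + t * z l)
      rw [← h3', hev z' h1' h2']
      have e := fun l => congrFun h3' l
      apply hW a.1 b.1 c.1 hab hbc z'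
      · rw [e a, e b, h1]; ring
      · rw [e a, e c, h2]; ring) 1
    simpa using this
  · refine hdeg.trans (totalDegree_subst_le g ?_ p)
    intro l
    simp only [hg]
    split_ifs
    · exact (totalDegree_X _).le
    · simp [totalDegree_C]
    · rw [totalDegree_C]; omega
  · intro z hi hj
    rw [← hev z hi hj, hr, map_mul, map_prod]
    simp

theorem card_sub {I : Type} [Fintype I] {i j : I} (hij : i ≠ j) {n : ℕ}
    (hI : Fintype.card I = 2 * (n + 1)) :
    Fintype.card {l : I // l ≠ i ∧ l ≠ j} = 2 * n := by
  have h : Fintype.card {l : I // l ≠ i ∧ l ≠ j} = (({i, j} : Finset I)ᶜ).card := by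
    rw [Fintype.card_subtype]
    congr 1
    ext l
    simp
  rw [h, Finset.card_compl, Finset.card_pair hij]
  omega

theorem deg_succ (n : ℕ) : (n + 1) * (n + 1 - 1) = n * (n - 1) + 2 * n := by
  cases n with
  | zero => rfl
  | succ m => simp; ring

/-- Vanishing on the hyperplane `z j = q² z i` (away from `z i = 0`). -/
def Van {I : Type} (i j : I) (p : MvPolynomial I ℂ) : Prop :=
  ∀ z : I → ℂ, z i ≠ 0 → z j = q ^ 2 * z i → eval z p = 0

theorem WH.outside {I : Type} {ρ : I → ℕ} (hρ : Function.Injective ρ) {p : MvPolynomial I ℂ}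
    (h : WH ρ p) {i j l : I} (hij : ρ i < ρ j) (hl : ¬ (ρ i < ρ l ∧ ρ l < ρ j)) (hli : l ≠ i)
    (hlj : l ≠ j) (z : I → ℂ) (h1 : z j = q ^ 2 * z i) (h2 : z l = q ^ 4 * z i) :
    eval z p = 0 := by
  have a1 : ρ l ≠ ρ i := fun e => hli (hρ e)
  have a2 : ρ l ≠ ρ j := fun e => hlj (hρ e)
  by_cases h3 : ρ l < ρ i
  · refine h l i j h3 hij z ?_ ?_
    · rw [h2]; linear_combination (-(q ^ 3 + 1) * z i) * q_cube
    · rw [h2, h1]; linear_combination (-(q ^ 5 + q ^ 2) * z i) * q_cube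
  · exact h i j l hij (by omega) z h1 h2

/-- Removal of an adjacent pair. -/
theorem red_adj {I : Type} [Fintype I] {ρ : I → ℕ} (hρ : Function.Injective ρ)
    {p : MvPolynomial I ℂ} (hW : WH ρ p) {i j : I} (hij : ρ i < ρ j)
    (hadj : ∀ l, ¬ (ρ i < ρ l ∧ ρ l < ρ j)) {w : ℂ} (hw : w ≠ 0) :
    ∃ r : MvPolynomial {l : I // l ≠ i ∧ l ≠ j} ℂ, WH (fun l => ρ l.1) r ∧
      (r = 0 ∨ r.totalDegree + Fintype.card {l : I // l ≠ i ∧ l ≠ j} ≤ p.totalDegree) ∧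
      ∀ z : I → ℂ, z i = w → z j = q ^ 2 * w →
        eval z p = (∏ l : {l : I // l ≠ i ∧ l ≠ j}, (z l.1 - q ^ 4 * w)) *
          eval (fun l => z l.1) r := by
  have hne : i ≠ j := by rintro rfl; omega
  have hinj : Function.Injective
      (fun l : {l : I // l ≠ i ∧ l ≠ j} => (l, q ^ 4 * w)) := fun a b h => (Prod.mk.inj h).1
  obtain ⟨r, h1, h2, h3⟩ := red ρ p hW i j hne w (Finset.univ.image (fun l => (l, q ^ 4 * w)))
    (by
      intro t ht
      simp only [Finset.mem_image, Finset.mem_univ, true_and] at ht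
      obtain ⟨l, rfl⟩ := ht
      exact mul_ne_zero (pow_ne_zero _ q_ne_zero) hw)
    (by
      intro t ht z hi hj hl
      simp only [Finset.mem_image, Finset.mem_univ, true_and] at ht
      obtain ⟨l, rfl⟩ := ht
      simp only at hl
      exact hW.outside hρ hij (hadj l.1) l.2.1 l.2.2 z (by rw [hj, hi]) (by rw [hl, hi]))
  refine ⟨r, h1, ?_, ?_⟩
  · rwa [Finset.card_image_of_injective _ hinj, Finset.card_univ] at h2
  · intro z hi hj
    rw [h3 z hi hj, Finset.prod_image (fun a _ b _ h => hinj h)]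


theorem linq_hL {I : Type} {i j : I} (hij : i ≠ j) :
    aeval (Function.update X j (C (q ^ 2) * X i)) (C (q ^ 2) * X i : MvPolynomial I ℂ) =
      C (q ^ 2) * X i := by
  rw [map_mul, aeval_C, aeval_X, Function.update_of_ne hij, algebraMap_eq]

theorem linq_prime {I : Type} {i j : I} (hij : i ≠ j) :
    Prime (X j - C (q ^ 2) * X i : MvPolynomial I ℂ) := by
  apply lin_prime _ _ (linq_hL hij)
  intro h
  have := congrArg (eval (fun l => if l = j then 1 else 0)) h
  simp [hij] at this

/-- Too many hyperplanes. -/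
theorem many {I : Type} [Fintype I] {ρ : I → ℕ} (hρ : Function.Injective ρ)
    {n : ℕ} (hI : Fintype.card I = 2 * (n + 1))
    {p : MvPolynomial I ℂ} (hdeg : p.totalDegree ≤ (n + 1) * n)
    (hv : ∀ i j, ρ i < ρ j → Van i j p) : p = 0 := by
  by_contra h0
  set T : Finset (I × I) := Finset.univ.filter (fun t => ρ t.1 < ρ t.2) with hT
  obtain ⟨r, _, hd⟩ := prod_factor T
    (fun t => (X t.2 - C (q ^ 2) * X t.1 : MvPolynomial I ℂ))
    (by
      intro t ht
      apply linq_prime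
      simp only [hT, Finset.mem_filter] at ht
      intro h; rw [h] at ht; omega)
    (by
      rintro ⟨i, j⟩ ht ⟨i', j'⟩ hs hne hd
      simp only [hT, Finset.mem_filter, Finset.mem_univ, true_and] at ht hs
      have h1 : i ≠ j := by rintro rfl; omega
      have h2 : i' ≠ j' := by rintro rfl; omega
      rw [lin_dvd_iff_eval _ _ _ (linq_hL h1)] at hd
      by_cases hc : j' ≠ j ∧ j' ≠ i
      · have := hd (fun l => if l = j' then 1 else 0) (by simp [hc.1.symm, hc.2.symm])
        simp [h2] at this
      · have h3 : i' ≠ i := by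
          rintro rfl
          apply hne
          have : j' ≠ i' := h2.symm
          have : j' = j := by tauto
          rw [this]
        have h4 : i' ≠ j := by
          rintro rfl
          have : j' = i := by
            by_contra h
            exact hc ⟨h2.symm, h⟩
          subst this; omega
        have := hd (fun l => if l = i then 1 else if l = j then q ^ 2 else 0) (by simp [h1.symm])
        simp only [map_sub, map_mul, eval_X, eval_C, h3, h4, if_false, mul_zero, sub_zero] at this
        by_cases h5 : j' = i
        · simp [h5] at this
        · have h6 : j' = j := by tauto
          simp [h6, h1.symm, q_ne_zero] at this)
    p h0 (by
      rintro ⟨i, j⟩ ht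
      simp only [hT, Finset.mem_filter, Finset.mem_univ, true_and] at ht
      have h1 : i ≠ j := by rintro rfl; omega
      have h2 : (X j - C (q ^ 2) * X i : MvPolynomial I ℂ) ∣ X i * p := by
        rw [lin_dvd_iff_eval _ _ _ (linq_hL h1)]
        intro z hz
        by_cases hzi : z i = 0
        · simp [hzi]
        · rw [map_mul, hv i j ht z hzi (by simpa using hz), mul_zero]
      rcases (linq_prime h1).dvd_or_dvd h2 with h3 | h3
      · rw [lin_dvd_iff_eval _ _ _ (linq_hL h1)] at h3
        have := h3 (fun l => if l = i then 1 else q ^ 2) (by simp [h1.symm])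
        simp at this
      · exact h3)
  have hcard : (n + 1) * n < T.card := by
    have e1 : (Finset.univ : Finset (I × I)).card = (2 * (n + 1)) * (2 * (n + 1)) := by
      rw [Finset.card_univ, Fintype.card_prod, hI]
    have e2 : (Finset.univ : Finset (I × I)) ⊆ T ∪ (T.image Prod.swap ∪
        Finset.univ.image (fun i : I => (i, i))) := by
      rintro ⟨i, j⟩ _
      simp only [hT, Finset.mem_union, Finset.mem_filter, Finset.mem_univ, true_and,
        Finset.mem_image, Prod.exists]
      rcases lt_trichotomy (ρ i) (ρ j) with h | h | h
      · exact Or.inl h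
      · exact Or.inr (Or.inr ⟨i, by rw [hρ h]⟩)
      · exact Or.inr (Or.inl ⟨j, i, h, rfl⟩)
    have e3 := Finset.card_le_card e2
    have e4 := Finset.card_union_le T (T.image Prod.swap ∪
        Finset.univ.image (fun i : I => (i, i)))
    have e5 := Finset.card_union_le (T.image Prod.swap)
        (Finset.univ.image (fun i : I => (i, i)))
    have e6 : (T.image Prod.swap).card ≤ T.card := Finset.card_image_le
    have e7 : (Finset.univ.image (fun i : I => (i, i))).card ≤ 2 * (n + 1) := by
      rw [← hI]; exact Finset.card_image_le
    nlinarith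
  omega

/-- The statement that low degree wheel polynomials vanish. -/
def ZZ (n : ℕ) : Prop := ∀ (I : Type) [Fintype I] (ρ : I → ℕ) (_ : Function.Injective ρ)
  (_ : Fintype.card I = 2 * n) (p : MvPolynomial I ℂ) (_ : WH ρ p)
  (_ : p.totalDegree < n * (n - 1)), p = 0

theorem adj_suffices {n : ℕ} (hZ : ZZ n) {I : Type} [Fintype I] {ρ : I → ℕ}
    (hρ : Function.Injective ρ) (hI : Fintype.card I = 2 * (n + 1))
    {p : MvPolynomial I ℂ} (hW : WH ρ p) (hdeg : p.totalDegree ≤ (n + 1) * (n + 1 - 1))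
    (hv : ∀ i j, ρ i < ρ j → (∀ l, ¬ (ρ i < ρ l ∧ ρ l < ρ j)) → Van i j p) : p = 0 := by
  apply many hρ hI hdeg
  suffices H : ∀ d i j, ρ i < ρ j → ρ j = ρ i + d → Van i j p by
    intro i j hij
    exact H (ρ j - ρ i) i j hij (by omega)
  intro d
  induction d using Nat.strong_induction_on with
  | _ d ih =>
  intro i j hij hd
  by_cases hadj : ∀ l, ¬ (ρ i < ρ l ∧ ρ l < ρ j)
  · exact hv i j hij hadj
  push Not at hadj
  obtain ⟨l0, hl1, hl2⟩ := hadj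
  have hne : i ≠ j := by rintro rfl; omega
  have hl0 : l0 ≠ i ∧ l0 ≠ j := ⟨by rintro rfl; omega, by rintro rfl; omega⟩
  intro z0 hz0 hz0'
  set w := z0 i with hw
  set F : {l : I // l ≠ i ∧ l ≠ j} → {l : I // l ≠ i ∧ l ≠ j} × ℂ := fun l =>
    (l, if ρ i < ρ l.1 ∧ ρ l.1 < ρ j then q ^ 2 * w else q ^ 4 * w) with hF
  have hinj : Function.Injective F := fun a b h => (Prod.mk.inj h).1
  have hnot : ((⟨l0, hl0⟩, w) : {l : I // l ≠ i ∧ l ≠ j} × ℂ) ∉ Finset.univ.image F := by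
    intro h
    simp only [Finset.mem_image, Finset.mem_univ, true_and] at h
    obtain ⟨l, hl⟩ := h
    have e1 := (Prod.mk.inj hl).1
    have e2 := (Prod.mk.inj hl).2
    rw [e1] at e2
    simp only [hl1, hl2, and_self, if_true] at e2
    apply q_sq_ne_one
    exact mul_right_cancel₀ hz0 (by rw [e2, one_mul])
  obtain ⟨r, h1, h2, h3⟩ := red ρ p hW i j hne w (insert (⟨l0, hl0⟩, w) (Finset.univ.image F))
    (by
      intro t ht
      simp only [Finset.mem_insert, Finset.mem_image, Finset.mem_univ, true_and] at ht
      rcases ht with rfl | ⟨l, rfl⟩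
      · exact hz0
      · simp only [hF]
        split_ifs
        · exact mul_ne_zero (pow_ne_zero _ q_ne_zero) hz0
        · exact mul_ne_zero (pow_ne_zero _ q_ne_zero) hz0)
    (by
      intro t ht z hi hj hl
      simp only [Finset.mem_insert, Finset.mem_image, Finset.mem_univ, true_and] at ht
      rcases ht with rfl | ⟨l, rfl⟩
      · simp only at hl
        exact ih (ρ j - ρ l0) (by omega) l0 j hl2 (by omega) z (by rw [hl]; exact hz0)
          (by rw [hl, hj])
      · simp only [hF] at hl
        split_ifs at hl with hc
        · exact ih (ρ l.1 - ρ i) (by omega) i l.1 hc.1 (by omega) z (by rw [hi]; exact hz0)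
            (by rw [hl, hi])
        · exact hW.outside hρ hij hc l.2.1 l.2.2 z (by rw [hj, hi]) (by rw [hl, hi]))
  have hr : r = 0 := by
    rcases h2 with h2 | h2
    · exact h2
    · rw [Finset.card_insert_of_notMem hnot, Finset.card_image_of_injective _ hinj,
        Finset.card_univ, card_sub hne hI] at h2
      rw [deg_succ] at hdeg
      exact hZ _ (fun l => ρ l.1) (fun a b h => Subtype.ext (hρ h)) (card_sub hne hI) r h1
        (by omega)
  rw [h3 z0 rfl hz0', hr]
  simp

theorem ZZ_all (n : ℕ) : ZZ n := by
  induction n with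
  | zero => intro I _ ρ _ _ p _ h; omega
  | succ n hZ =>
    intro I _ ρ hρ hI p hW hdeg
    refine adj_suffices hZ hρ hI hW hdeg.le ?_
    intro i j hij hadj z hz hz'
    have hne : i ≠ j := by rintro rfl; omega
    obtain ⟨r, h1, h2, h3⟩ := red_adj hρ hW hij hadj hz
    have hr : r = 0 := by
      rcases h2 with h2 | h2
      · exact h2
      · rw [card_sub hne hI] at h2
        rw [deg_succ] at hdeg
        exact hZ _ (fun l => ρ l.1) (fun a b h => Subtype.ext (hρ h)) (card_sub hne hI) r h1
          (by omega)
    rw [h3 z rfl hz', hr]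
    simp

theorem eval_scale {I : Type} {p : MvPolynomial I ℂ} {d : ℕ} (hp : p.IsHomogeneous d) (c : ℂ)
    (z : I → ℂ) : eval (fun l => c * z l) p = c ^ d * eval z p := by
  rw [eval_eq, eval_eq, Finset.mul_sum]
  apply Finset.sum_congr rfl
  intro m hm
  have h1 : m.degree = d := by
    have := hp (mem_support_iff.mp hm)
    rw [← this, Finsupp.degree_eq_weight_one]
    rfl
  simp only [mul_pow, Finset.prod_mul_distrib]
  have h2 : ∑ x ∈ m.support, m x = d := h1
  rw [Finset.prod_pow_eq_pow_sum, h2]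
  ring

theorem WH.comp {I : Type} {ρ : I → ℕ} {p : MvPolynomial I ℂ} (h : WH ρ p) (d : ℕ) :
    WH ρ (homogeneousComponent d p) := by
  intro i j k hij hjk z h1 h2
  set N := max p.totalDegree d with hN
  have hsum : ∀ c : ℂ, ∑ e ∈ Finset.range (N + 1), c ^ e * eval z (homogeneousComponent e p)
      = 0 := by
    intro c
    have h3 := h i j k hij hjk (fun l => c * z l) (by rw [h1]; ring) (by rw [h2]; ring)
    rw [← h3]
    conv_rhs => rw [← sum_homogeneousComponent p]
    rw [map_sum]
    symm
    rw [Finset.sum_subset (s₂ := Finset.range (N + 1))]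
    · apply Finset.sum_congr rfl
      intro e _
      rw [eval_scale (homogeneousComponent_isHomogeneous e p)]
    · intro e he
      simp only [Finset.mem_range] at he ⊢
      omega
    · intro e _ he
      simp only [Finset.mem_range] at he
      rw [homogeneousComponent_eq_zero _ _ (by omega), map_zero]
  have hp : (∑ e ∈ Finset.range (N + 1),
      Polynomial.C (eval z (homogeneousComponent e p)) * Polynomial.X ^ e) = 0 := by
    apply Polynomial.funext
    intro c
    rw [Polynomial.eval_finsetSum, Polynomial.eval_zero, ← hsum c]
    apply Finset.sum_congr rfl
    intro e _
    rw [Polynomial.eval_mul, Polynomial.eval_C, Polynomial.eval_pow, Polynomial.eval_X, mul_comm]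
  have := congrArg (fun f => Polynomial.coeff f d) hp
  simp only [Polynomial.finsetSum_coeff, Polynomial.coeff_C_mul_X_pow, Polynomial.coeff_zero] at this
  rw [Finset.sum_ite_eq] at this
  rw [if_pos (by simp; omega)] at this
  exact this

theorem homog_of_WH {n : ℕ} {I : Type} [Fintype I] {ρ : I → ℕ} (hρ : Function.Injective ρ)
    (hI : Fintype.card I = 2 * n) {p : MvPolynomial I ℂ} (hW : WH ρ p)
    (hdeg : p.totalDegree ≤ n * (n - 1)) : p.IsHomogeneous (n * (n - 1)) := by
  have h : p = homogeneousComponent (n * (n - 1)) p := by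
    conv_lhs => rw [← sum_homogeneousComponent p]
    rw [Finset.sum_subset (s₂ := Finset.range (n * (n - 1) + 1))]
    · rw [Finset.sum_range_succ, Finset.sum_eq_zero, zero_add]
      intro e he
      simp only [Finset.mem_range] at he
      exact ZZ_all n I ρ hρ hI _ (hW.comp e)
        (lt_of_le_of_lt (homogeneousComponent_isHomogeneous e p).totalDegree_le he)
    · intro e he
      simp only [Finset.mem_range] at he ⊢
      omega
    · intro e _ he
      simp only [Finset.mem_range] at he
      rw [homogeneousComponent_eq_zero _ _ (by omega)]
  rw [h]
  exact homogeneousComponent_isHomogeneous _ _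


/-- Noncrossing matchings with respect to a rank function. -/
def IsNC {I : Type} (ρ : I → ℕ) (f : I → I) : Prop :=
  (∀ k, f (f k) = k) ∧ (∀ k, f k ≠ k) ∧
  ∀ a b c d, ρ a < ρ b → ρ b < ρ c → ρ c < ρ d → f a = c → f b = d → False

/-- The evaluation point of a matching. -/
noncomputable def pt {I : Type} (ρ : I → ℕ) (f : I → I) (k : I) : ℂ :=
  if ρ k < ρ (f k) then q⁻¹ else q

theorem pt_sub_ne {I : Type} (ρ : I → ℕ) (f : I → I) (k : I) :
    pt ρ f k - q ^ 4 * q⁻¹ ≠ 0 := by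
  have h : q ^ 4 * q⁻¹ = 1 := by rw [q_inv]; linear_combination (q ^ 3 + 1) * q_cube
  rw [h, pt]
  split_ifs
  · rw [q_inv]; exact sub_ne_zero.mpr q_sq_ne_one
  · exact sub_ne_zero.mpr q_ne_one

theorem uniq (n : ℕ) : ∀ (I : Type) [Fintype I] (ρ : I → ℕ) (_ : Function.Injective ρ)
    (_ : Fintype.card I = 2 * n) (p : MvPolynomial I ℂ) (_ : WH ρ p)
    (_ : p.totalDegree ≤ n * (n - 1)) (_ : ∀ f, IsNC ρ f → eval (pt ρ f) p = 0), p = 0 := by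
  induction n with
  | zero =>
    intro I _ ρ hρ hI p hW hdeg hev
    have hemp : IsEmpty I := Fintype.card_eq_zero_iff.mp hI
    have h := hev id ⟨fun k => hemp.elim k, fun k => hemp.elim k, fun k => hemp.elim k⟩
    have h0 := totalDegree_eq_zero_iff_eq_C.mp (Nat.le_zero.mp hdeg)
    rw [h0, eval_C] at h
    rw [h0, h, C_0]
  | succ n ih =>
    intro I _ ρ hρ hI p hW hdeg hev
    have hhom := homog_of_WH hρ hI hW hdeg
    refine adj_suffices (ZZ_all n) hρ hI hW hdeg ?_
    intro i j hij hadj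
    have hne : i ≠ j := by rintro rfl; omega
    obtain ⟨r, h1, h2, h3⟩ := red_adj hρ hW hij hadj (inv_ne_zero q_ne_zero)
    have hρ' : Function.Injective (fun l : {l : I // l ≠ i ∧ l ≠ j} => ρ l.1) :=
      fun a b h => Subtype.ext (hρ h)
    have hr : r = 0 := by
      rcases h2 with h2 | h2
      · exact h2
      rw [card_sub hne hI] at h2
      rw [deg_succ] at hdeg
      refine ih _ (fun l => ρ l.1) hρ' (card_sub hne hI) r h1 (by omega) ?_
      intro g hg
      set f : I → I := fun k => if k = i then j else if k = j then i else
        if h : k ≠ i ∧ k ≠ j then (g ⟨k, h⟩).1 else k with hf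
      have fi : f i = j := by simp [hf]
      have fj : f j = i := by simp [hf, hne.symm]
      have fl : ∀ l : {l : I // l ≠ i ∧ l ≠ j}, f l.1 = (g l).1 := by
        intro l
        simp [hf, l.2.1, l.2.2]
      have cases3 : ∀ k : I, k = i ∨ k = j ∨ ∃ l : {l : I // l ≠ i ∧ l ≠ j}, k = l.1 := by
        intro k
        by_cases h : k = i
        · exact Or.inl h
        · by_cases h' : k = j
          · exact Or.inr (Or.inl h')
          · exact Or.inr (Or.inr ⟨⟨k, h, h'⟩, rfl⟩)
      have hNC : IsNC ρ f := by
        refine ⟨?_, ?_, ?_⟩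
        · intro k
          rcases cases3 k with rfl | rfl | ⟨l, rfl⟩
          · rw [fi, fj]
          · rw [fj, fi]
          · rw [fl, fl, hg.1]
        · intro k
          rcases cases3 k with rfl | rfl | ⟨l, rfl⟩
          · rw [fi]; exact hne.symm
          · rw [fj]; exact hne
          · rw [fl]; exact fun h => hg.2.1 l (Subtype.ext h)
        · intro a b c d hab hbc hcd hac hbd
          rcases cases3 a with rfl | rfl | ⟨a, rfl⟩
          · rw [fi] at hac; subst hac
            exact hadj b ⟨hab, hbc⟩
          · rw [fj] at hac; subst hac; omega
          · rcases cases3 b with rfl | rfl | ⟨b, rfl⟩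
            · rw [fi] at hbd; subst hbd
              exact hadj c ⟨hbc, hcd⟩
            · rw [fj] at hbd; subst hbd; omega
            · rw [fl] at hac hbd
              subst hac; subst hbd
              exact hg.2.2 a b (g a) (g b) hab hbc hcd rfl rfl
      have e := h3 (pt ρ f) (by rw [pt, fi, if_pos hij])
        (by
          rw [pt, fj, if_neg (by omega), q_inv]
          linear_combination -q * q_cube)
      rw [hev f hNC] at e
      have e2 : (fun l : {l : I // l ≠ i ∧ l ≠ j} => pt ρ f l.1) = pt (fun l => ρ l.1) g := by
        funext l
        simp only [pt, fl]
      rw [e2] at e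
      rcases mul_eq_zero.mp e.symm with e3 | e3
      · rw [Finset.prod_eq_zero_iff] at e3
        obtain ⟨l, _, hl⟩ := e3
        exact absurd hl (pt_sub_ne _ _ _)
      · exact e3
    intro z hz hz'
    have hc : q⁻¹ / z i ≠ 0 := div_ne_zero (inv_ne_zero q_ne_zero) hz
    have e := eval_scale hhom (q⁻¹ / z i) z
    rw [h3 (fun l => q⁻¹ / z i * z l) (by field_simp) (by rw [hz']; field_simp), hr,
      map_zero, mul_zero] at e
    exact (mul_eq_zero.mp e.symm).resolve_left (pow_ne_zero _ hc)

/-- Existence of a short arch avoiding the first point. -/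
theorem exists_arch {I : Type} [Fintype I] {ρ : I → ℕ} (hρ : Function.Injective ρ)
    {f : I → I} (hf : IsNC ρ f) (m0 : I) (hm : ∀ k, k ≠ m0 → ρ m0 < ρ k)
    (hI : 3 ≤ Fintype.card I) :
    ∃ i, i ≠ m0 ∧ f i ≠ m0 ∧ ρ i < ρ (f i) ∧ ∀ l, ¬ (ρ i < ρ l ∧ ρ l < ρ (f i)) := by
  have hex : ∃ k, k ≠ m0 ∧ k ≠ f m0 := by
    by_contra h
    push Not at h
    have : (Finset.univ : Finset I) ⊆ {m0, f m0} := by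
      intro k _
      by_cases hk : k = m0
      · simp [hk]
      · simp [h k hk]
    have h2 := Finset.card_le_card this
    have h3 := Finset.card_le_two (a := m0) (b := f m0)
    rw [Finset.card_univ] at h2
    omega
  have hinv := hf.1
  have hex2 : ∃ d i, i ≠ m0 ∧ f i ≠ m0 ∧ ρ i < ρ (f i) ∧ ρ (f i) - ρ i = d := by
    obtain ⟨k, hk1, hk2⟩ := hex
    have hk3 : f k ≠ m0 := fun h => hk2 (by rw [← h, hinv])
    rcases lt_trichotomy (ρ k) (ρ (f k)) with h | h | h
    · exact ⟨_, k, hk1, hk3, h, rfl⟩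
    · exact absurd (hρ h).symm (hf.2.1 k)
    · exact ⟨_, f k, hk3, by rwa [hinv], by rwa [hinv], rfl⟩
  obtain ⟨i, h1, h2, h3, h4⟩ := Nat.find_spec hex2
  refine ⟨i, h1, h2, h3, ?_⟩
  rintro l ⟨hl1, hl2⟩
  have hli : l ≠ i := by rintro rfl; omega
  have hlj : l ≠ f i := by rintro rfl; omega
  have hfl1 : ρ i < ρ (f l) := by
    by_contra hc
    have h5 : ρ (f l) ≠ ρ i := fun h => hlj (by rw [← hρ h, hinv])
    exact hf.2.2 (f l) i l (f i) (by omega) hl1 hl2 (hinv l) rfl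
  have hfl2 : ρ (f l) < ρ (f i) := by
    by_contra hc
    have h5 : ρ (f l) ≠ ρ (f i) := fun h => hli (by
      have := congrArg f (hρ h); rwa [hinv, hinv] at this)
    exact hf.2.2 i l (f i) (f l) hl1 hl2 (by omega) rfl rfl
  have hm0 := hm i h1
  have hlm : l ≠ m0 := by rintro rfl; omega
  have hflm : f l ≠ m0 := by intro h; rw [h] at hfl1; omega
  rcases lt_trichotomy (ρ l) (ρ (f l)) with h | h | h
  · exact Nat.find_min hex2 (m := ρ (f l) - ρ l) (by omega) ⟨l, hlm, hflm, h, rfl⟩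
  · exact absurd (hρ h).symm (hf.2.1 l)
  · exact Nat.find_min hex2 (m := ρ l - ρ (f l)) (by omega)
      ⟨f l, hflm, by rwa [hinv], by rwa [hinv], by rw [hinv]⟩

theorem flip_eval (n : ℕ) : ∀ (I : Type) [Fintype I] (ρ : I → ℕ)
    (_ : Function.Injective ρ)
    (_ : Fintype.card I = 2 * n) (p : MvPolynomial I ℂ) (_ : WH ρ p)
    (_ : p.totalDegree ≤ n * (n - 1)) (f : I → I) (_ : IsNC ρ f) (m0 : I)
    (_ : ∀ k, k ≠ m0 → ρ m0 < ρ k),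
    eval (pt ρ f) p = eval (fun k => pt ρ f (Equiv.swap m0 (f m0) k)) p := by
  induction n with
  | zero =>
    intro I _ ρ hρ hI p hW hdeg f hf m0 hm
    have hemp : IsEmpty I := Fintype.card_eq_zero_iff.mp hI
    exact hemp.elim m0
  | succ n ih =>
    intro I _ ρ hρ hI p hW hdeg f hf m0 hm
    by_cases hn : n = 0
    · subst hn
      have h0 := totalDegree_eq_zero_iff_eq_C.mp (Nat.le_zero.mp hdeg)
      rw [h0, eval_C, eval_C]
    obtain ⟨i, h1, h2, hij, hadj⟩ := exists_arch hρ hf m0 hm (by omega)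
    have hinv := hf.1
    have hne : i ≠ f i := (hf.2.1 i).symm
    obtain ⟨r, hr1, hr2, hr3⟩ := red_adj hρ hW hij hadj (inv_ne_zero q_ne_zero)
    have hρ' : Function.Injective (fun l : {l : I // l ≠ i ∧ l ≠ f i} => ρ l.1) :=
      fun a b h => Subtype.ext (hρ h)
    have hrd : r.totalDegree ≤ n * (n - 1) := by
      rcases hr2 with hr2 | hr2
      · rw [hr2]; simp
      · rw [card_sub hne hI] at hr2
        rw [deg_succ] at hdeg
        omega
    have hmem : ∀ l, l ≠ i ∧ l ≠ f i → f l ≠ i ∧ f l ≠ f i := by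
      rintro l ⟨ha, hb⟩
      refine ⟨fun h => hb (by rw [← h, hinv]), fun h => ha ?_⟩
      have := congrArg f h
      rwa [hinv, hinv] at this
    set g : {l : I // l ≠ i ∧ l ≠ f i} → {l : I // l ≠ i ∧ l ≠ f i} :=
      fun l => ⟨f l.1, hmem l.1 l.2⟩ with hg
    have hgNC : IsNC (fun l : {l : I // l ≠ i ∧ l ≠ f i} => ρ l.1) g := by
      refine ⟨fun k => Subtype.ext (hinv k.1), fun k h => hf.2.1 k.1 (congrArg Subtype.val h), ?_⟩
      intro a b c d hab hbc hcd hac hbd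
      exact hf.2.2 a.1 b.1 c.1 d.1 hab hbc hcd (congrArg Subtype.val hac)
        (congrArg Subtype.val hbd)
    have hm0 : m0 ≠ i ∧ m0 ≠ f i := ⟨h1.symm, h2.symm⟩
    have key := ih _ (fun l : {l : I // l ≠ i ∧ l ≠ f i} => ρ l.1) hρ' (card_sub hne hI) r hr1 hrd
      g hgNC ⟨m0, hm0⟩ (fun k hk => hm k.1 (fun h => hk (Subtype.ext h)))
    have hfm := hmem m0 hm0
    have p1 : pt ρ f i = q⁻¹ := by rw [pt, if_pos hij]
    have p2 : pt ρ f (f i) = q ^ 2 * q⁻¹ := by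
      rw [pt, hinv, if_neg (by omega), q_inv]
      linear_combination -q * q_cube
    have hsw : ∀ l : {l : I // l ≠ i ∧ l ≠ f i},
        Equiv.swap m0 (f m0) l.1 = (Equiv.swap (⟨m0, hm0⟩ : {l : I // l ≠ i ∧ l ≠ f i})
          (g ⟨m0, hm0⟩) l).1 := by
      intro l
      rw [Equiv.swap_apply_def, Equiv.swap_apply_def]
      simp only [hg, Subtype.ext_iff]
      split_ifs <;> rfl
    rw [hr3 (pt ρ f) p1 p2, hr3 (fun k => pt ρ f (Equiv.swap m0 (f m0) k))
      (by rw [Equiv.swap_apply_of_ne_of_ne hm0.1.symm hfm.1.symm, p1])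
      (by rw [Equiv.swap_apply_of_ne_of_ne hm0.2.symm hfm.2.symm, p2])]
    have e2 : (fun l : {l : I // l ≠ i ∧ l ≠ f i} => pt ρ f l.1) = pt (fun l => ρ l.1) g := by
      funext l
      simp only [pt, hg]
    congr 1
    · simp only [hsw]
      exact (Equiv.prod_comp (Equiv.swap (⟨m0, hm0⟩ : {l : I // l ≠ i ∧ l ≠ f i})
          (g ⟨m0, hm0⟩)) (fun l => (pt ρ f l.1 - q ^ 4 * q⁻¹))).symm
    · rw [e2, key]
      simp only [hsw]
      congr 2
      funext l
      refine (congrFun e2 _).symm.trans ?_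
      congr!


theorem cut_step {n : ℕ} {I : Type} [Fintype I] {ρ ρ' : I → ℕ}
    (hρ : Function.Injective ρ) (hI : Fintype.card I = 2 * n) {p : MvPolynomial I ℂ}
    (hW : WH ρ p) (hdeg : p.totalDegree ≤ n * (n - 1)) {f : I → I} (hf : IsNC ρ f) (m0 : I)
    (hm : ∀ k, k ≠ m0 → ρ m0 < ρ k) (h1 : ∀ k, k ≠ m0 → ρ' k = ρ k)
    (h2 : ∀ k, k ≠ m0 → ρ k < ρ' m0) : eval (pt ρ f) p = eval (pt ρ' f) p := by
  rw [flip_eval n I ρ hρ hI p hW hdeg f hf m0 hm]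
  congr 2
  funext k
  have hne := hf.2.1 m0
  by_cases hk : k = m0
  · subst hk
    rw [Equiv.swap_apply_left, pt, pt, hf.1]
    have a1 := hm _ hne
    have a2 := h2 _ hne
    rw [h1 _ hne, if_neg (by omega), if_neg (by omega)]
  · by_cases hk2 : k = f m0
    · subst hk2
      rw [Equiv.swap_apply_right, pt, pt, hf.1]
      have a1 := hm _ hne
      have a2 := h2 _ hne
      rw [h1 _ hne, if_pos (by omega), if_pos (by omega)]
    · rw [Equiv.swap_apply_of_ne_of_ne hk hk2, pt, pt]
      have hfk : f k ≠ m0 := fun h => hk2 (by rw [← h, hf.1])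
      rw [h1 _ hk, h1 _ hfk]

theorem IsNC.cyc {I : Type} {ρ ρ' : I → ℕ} {f : I → I} (h : IsNC ρ f)
    (hc : ∀ a b c d, ρ' a < ρ' b → ρ' b < ρ' c → ρ' c < ρ' d →
      (ρ a < ρ b ∧ ρ b < ρ c ∧ ρ c < ρ d) ∨ (ρ b < ρ c ∧ ρ c < ρ d ∧ ρ d < ρ a) ∨
      (ρ c < ρ d ∧ ρ d < ρ a ∧ ρ a < ρ b) ∨ (ρ d < ρ a ∧ ρ a < ρ b ∧ ρ b < ρ c)) :
    IsNC ρ' f := by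
  refine ⟨h.1, h.2.1, ?_⟩
  intro a b c d hab hbc hcd hac hbd
  have hca : f c = a := by rw [← hac, h.1]
  have hdb : f d = b := by rw [← hbd, h.1]
  rcases hc a b c d hab hbc hcd with ⟨x, y, z⟩ | ⟨x, y, z⟩ | ⟨x, y, z⟩ | ⟨x, y, z⟩
  · exact h.2.2 a b c d x y z hac hbd
  · exact h.2.2 b c d a x y z hbd hca
  · exact h.2.2 c d a b x y z hca hdb
  · exact h.2.2 d a b c x y z hdb hac

/-- Rank in the order starting at `c`. -/
def rk (m c : ℕ) (k : Fin m) : ℕ := if k.val < c then k.val + m else k.val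

theorem rk_inj (m c : ℕ) : Function.Injective (rk m c) := by
  intro a b h
  have := a.2
  have := b.2
  apply Fin.ext
  simp only [rk] at h
  split_ifs at h <;> omega

theorem rk_zero (m : ℕ) : rk m 0 = fun k => k.val := by
  funext k; simp [rk]

theorem WH.rk {m c : ℕ} {p : MvPolynomial (Fin m) ℂ} (h : WH (rk m 0) p) :
    WH (rk m c) p := by
  refine h.cyc ?_
  intro i j k hij hjk
  have := i.2
  have := j.2
  have := k.2
  simp only [_root_.rk] at *
  split_ifs at hij hjk <;> simp only [Nat.not_lt_zero, if_false] <;> omega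

theorem WH.unrk {m c : ℕ} {p : MvPolynomial (Fin m) ℂ} (h : WH (_root_.rk m c) p) :
    WH (_root_.rk m 0) p := by
  refine h.cyc ?_
  intro i j k hij hjk
  have := i.2
  have := j.2
  have := k.2
  simp only [_root_.rk, Nat.not_lt_zero, if_false] at *
  split_ifs <;> omega

theorem IsNC.rk {m c : ℕ} {f : Fin m → Fin m} (h : IsNC (_root_.rk m 0) f) :
    IsNC (_root_.rk m c) f := by
  refine h.cyc ?_
  intro i j k l hij hjk hkl
  have := i.2
  have := j.2
  have := k.2
  have := l.2
  simp only [_root_.rk, Nat.not_lt_zero, if_false] at *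
  split_ifs at hij hjk hkl <;> omega

theorem IsNC.unrk {m c : ℕ} {f : Fin m → Fin m} (h : IsNC (_root_.rk m c) f) :
    IsNC (_root_.rk m 0) f := by
  refine h.cyc ?_
  intro i j k l hij hjk hkl
  have := i.2
  have := j.2
  have := k.2
  have := l.2
  simp only [_root_.rk, Nat.not_lt_zero, if_false] at *
  split_ifs <;> omega

theorem cut_eval {n : ℕ} {p : MvPolynomial (Fin (2 * n)) ℂ} (hW : WH (rk (2 * n) 0) p)
    (hdeg : p.totalDegree ≤ n * (n - 1)) {f : Fin (2 * n) → Fin (2 * n)}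
    (hf : IsNC (rk (2 * n) 0) f) (c : ℕ) (hc : c ≤ 2 * n) :
    eval (pt (rk (2 * n) 0) f) p = eval (pt (rk (2 * n) c) f) p := by
  induction c with
  | zero => rfl
  | succ c ih =>
    rw [ih (by omega)]
    have key : ∀ k : Fin (2 * n), k ≠ ⟨c, by omega⟩ → k.val ≠ c := fun k hk h => hk (Fin.ext h)
    refine cut_step (rk_inj _ _) (by simp) hW.rk hdeg hf.rk ⟨c, by omega⟩ ?_ ?_ ?_
    · intro k hk
      have := key k hk
      have := k.2
      simp only [rk]
      split_ifs <;> omega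
    · intro k hk
      have := key k hk
      simp only [rk]
      split_ifs <;> omega
    · intro k hk
      have := key k hk
      have := k.2
      simp only [rk]
      split_ifs <;> omega

theorem exists_S {I : Type} {a b : I} (hab : a ≠ b) (p : MvPolynomial I ℂ) :
    ∃ r, (X b - X a) * r = rename (Equiv.swap a b) p - p ∧
      (r = 0 ∨ r.totalDegree + 1 ≤ p.totalDegree) := by
  have hL : aeval (Function.update (X : I → MvPolynomial I ℂ) b (X a)) (X a : MvPolynomial I ℂ) = X a := by
    rw [aeval_X, Function.update_of_ne hab]
  have h : (X b - X a : MvPolynomial I ℂ) ∣ rename (Equiv.swap a b) p - p := by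
    rw [lin_dvd_iff_eval _ _ _ hL]
    intro z hz
    rw [eval_X] at hz
    rw [map_sub, eval_rename]
    have : z ∘ (Equiv.swap a b) = z := by
      funext k
      simp only [Function.comp, Equiv.swap_apply_def]
      split_ifs with h1 h2
      · rw [h1, hz]
      · rw [h2, hz]
      · rfl
    rw [this, sub_self]
  obtain ⟨r, hr⟩ := h
  refine ⟨r, hr.symm, ?_⟩
  by_cases h0 : r = 0
  · exact Or.inl h0
  right
  have hne : (X b - X a : MvPolynomial I ℂ) ≠ 0 := by
    intro h
    have := congrArg (eval (fun l => if l = b then 1 else 0)) h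
    simp [hab] at this
  have hpr := lin_prime b (X a) hL hne
  have h1 := prime_deg hpr
  have h2 := totalDegree_mul_of_isDomain hne h0
  rw [← hr] at h2
  have h3 := totalDegree_sub (rename (Equiv.swap a b) p) p
  have h4 := totalDegree_rename_le (Equiv.swap a b) p
  have h5 : max (rename (Equiv.swap a b) p).totalDegree p.totalDegree ≤ p.totalDegree :=
    max_le h4 le_rfl
  omega

theorem S_WH {I : Type} {ρ : I → ℕ} (hρ : Function.Injective ρ) {a b : I} (hab : ρ a < ρ b)
    (hadj : ∀ l, ¬ (ρ a < ρ l ∧ ρ l < ρ b)) {p r : MvPolynomial I ℂ} (hW : WH ρ p)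
    (hr : (X b - X a) * r = rename (Equiv.swap a b) p - p) :
    WH ρ ((C q * X a - C q⁻¹ * X b) * r) := by
  have hne : a ≠ b := by rintro rfl; omega
  have mono : ∀ x y, ρ x < ρ y → ¬ (x = a ∧ y = b) →
      ρ (Equiv.swap a b x) < ρ (Equiv.swap a b y) := by
    intro x y hxy hn
    have hx := hadj x
    have hy := hadj y
    have i1 : ∀ u v, u ≠ v → ρ u ≠ ρ v := fun u v h h' => h (hρ h')
    rw [Equiv.swap_apply_def, Equiv.swap_apply_def]
    split_ifs with h1 h2 h3 h4 h5 h6 h7 h8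
    · subst h1 h2; omega
    · exact absurd ⟨h1, h3⟩ hn
    · have := i1 _ _ h3; subst h1; omega
    · subst h4 h5; omega
    · subst h4 h6; omega
    · subst h4; omega
    · subst h7; omega
    · have := i1 _ _ h1; subst h8; omega
    · exact hxy
  intro i j k hij hjk z h1 h2
  rw [map_mul]
  by_cases hz : z b = q ^ 2 * z a
  · have : eval z (C q * X a - C q⁻¹ * X b) = 0 := by
      simp only [map_sub, map_mul, eval_C, eval_X, hz, q_inv]
      linear_combination (-q * z a) * q_cube
    rw [this, zero_mul]
  have hn1 : ¬ (i = a ∧ j = b) := by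
    rintro ⟨rfl, rfl⟩; exact hz h1
  have hn2 : ¬ (j = a ∧ k = b) := by
    rintro ⟨rfl, rfl⟩; apply hz; rw [h2, h1]; ring
  have hn3 : ¬ (i = a ∧ k = b) := by
    rintro ⟨rfl, rfl⟩; exact hadj j ⟨hij, hjk⟩
  have hx : ∃ x, (x = a ∨ x = b) ∧ x ≠ i ∧ x ≠ j ∧ x ≠ k := by
    by_cases ha : a ≠ i ∧ a ≠ j ∧ a ≠ k
    · exact ⟨a, Or.inl rfl, ha⟩
    · refine ⟨b, Or.inr rfl, ?_⟩
      have b1 : b = i → ρ b = ρ i := fun h => by rw [h]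
      have b2 : b = j → ρ b = ρ j := fun h => by rw [h]
      have b3 : b = k → ρ b = ρ k := fun h => by rw [h]
      by_cases c1 : a = i
      · subst c1
        exact ⟨hne.symm, fun h => hn1 ⟨rfl, h.symm⟩, fun h => hn3 ⟨rfl, h.symm⟩⟩
      · by_cases c2 : a = j
        · subst c2
          exact ⟨fun h => by have := b1 h; omega, hne.symm, fun h => hn2 ⟨rfl, h.symm⟩⟩
        · have c3 : a = k := by tauto
          subst c3
          exact ⟨fun h => by have := b1 h; omega, fun h => by have := b2 h; omega, hne.symm⟩
  obtain ⟨x, hxab, hxi, hxj, hxk⟩ := hx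
  have hzero : eval z r = 0 := by
    set v : I → ℂ := fun l => if l = x then 1 else 0 with hv
    have main := line_zero r (X b - X a) z v (if x = b then z a - z b + 1 else z b - z a + 1)
      (by
        rcases hxab with rfl | rfl
        · simp only [map_sub, eval_X, hv, if_neg hne, if_neg hne.symm, if_true]
          intro h
          apply one_ne_zero (α := ℂ)
          linear_combination -h
        · simp only [map_sub, eval_X, hv, if_neg hne, if_true]
          intro h
          apply one_ne_zero (α := ℂ)
          linear_combination h)
      (by
        intro t
        rw [← map_mul, hr, map_sub, eval_rename]
        have e1 : eval (fun l => z l + t * v l) p = 0 := by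
          apply hW i j k hij hjk <;> simp [hv, hxi.symm, hxj.symm, hxk.symm, h1, h2]
        have e2 : eval ((fun l => z l + t * v l) ∘ (Equiv.swap a b)) p = 0 := by
          apply hW _ _ _ (mono i j hij hn1) (mono j k hjk hn2) <;>
            simp [hv, hxi.symm, hxj.symm, hxk.symm, h1, h2]
        rw [e1, e2, sub_zero]) 0
    simpa using main
  rw [hzero, mul_zero]

theorem S_eval_arch {I : Type} {ρ : I → ℕ} {a b : I} (hab : ρ a < ρ b)
    (r : MvPolynomial I ℂ) {f : I → I} (hf : IsNC ρ f) (hfab : f a = b) :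
    eval (pt ρ f) ((C q * X a - C q⁻¹ * X b) * r) = 0 := by
  have hfb : f b = a := by rw [← hfab, hf.1]
  have h : eval (pt ρ f) (C q * X a - C q⁻¹ * X b) = 0 := by
    simp only [map_sub, map_mul, eval_C, eval_X, pt, hfab, hfb]
    rw [if_pos hab, if_neg (by omega)]
    ring
  rw [map_mul, h, zero_mul]

theorem S_eval {I : Type} {ρ : I → ℕ} (hρ : Function.Injective ρ) {a b : I} (hab : ρ a < ρ b)
    (hadj : ∀ l, ¬ (ρ a < ρ l ∧ ρ l < ρ b)) {f f' : I → I} (hf : IsNC ρ f) (hfab : f a ≠ b)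
    (hmin : ∀ k, k ≠ f a → ρ (f a) < ρ k) (e1 : f' a = b) (e2 : f' b = a)
    (e3 : f' (f a) = f b) (e4 : f' (f b) = f a)
    (e5 : ∀ m, m ≠ a → m ≠ b → m ≠ f a → m ≠ f b → f' m = f m) :
    IsNC ρ f' ∧ ∀ p r : MvPolynomial I ℂ, (X b - X a) * r = rename (Equiv.swap a b) p - p →
      eval (pt ρ f) ((C q * X a - C q⁻¹ * X b) * r) = eval (pt ρ f') p - eval (pt ρ f) p := by
  have hne : a ≠ b := by rintro rfl; omega
  have hinv := hf.1
  have hfix := hf.2.1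
  have hfba : f b ≠ a := fun h => hfab (by rw [← h, hinv])
  have hfafb : f a ≠ f b := fun h => hne (by have := congrArg f h; rwa [hinv, hinv] at this)
  have i1 : ∀ u v, u ≠ v → ρ u ≠ ρ v := fun u v h h' => h (hρ h')
  have ha := hmin a (hfix a).symm
  have hb := hmin b hfab.symm
  have hfb : ρ b < ρ (f b) := by
    by_contra hc
    have := i1 _ _ (hfix b)
    have := i1 _ _ hfba
    have := hmin _ hfafb.symm
    have := hadj (f b)
    exact hf.2.2 (f a) (f b) a b (by omega) (by omega) hab (hinv a) (hinv b)
  have cases5 : ∀ m, m = a ∨ m = b ∨ m = f a ∨ m = f b ∨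
      (m ≠ a ∧ m ≠ b ∧ m ≠ f a ∧ m ≠ f b) := by
    intro m; tauto
  have hstab : ∀ m, (m ≠ a ∧ m ≠ b ∧ m ≠ f a ∧ m ≠ f b) →
      (f m ≠ a ∧ f m ≠ b ∧ f m ≠ f a ∧ f m ≠ f b) := by
    rintro m ⟨h1, h2, h3, h4⟩
    refine ⟨fun h => h3 (by rw [← h, hinv]), fun h => h4 (by rw [← h, hinv]), fun h => h1 ?_,
      fun h => h2 ?_⟩
    · have := congrArg f h; rwa [hinv, hinv] at this
    · have := congrArg f h; rwa [hinv, hinv] at this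
  constructor
  · refine ⟨?_, ?_, ?_⟩
    · intro m
      rcases cases5 m with rfl | rfl | rfl | rfl | hm
      · rw [e1, e2]
      · rw [e2, e1]
      · rw [e3, e4]
      · rw [e4, e3]
      · rw [e5 m hm.1 hm.2.1 hm.2.2.1 hm.2.2.2]
        have h' := hstab m hm
        rw [e5 _ h'.1 h'.2.1 h'.2.2.1 h'.2.2.2, hinv]
    · intro m
      rcases cases5 m with rfl | rfl | rfl | rfl | hm
      · rw [e1]; exact hne.symm
      · rw [e2]; exact hne
      · rw [e3]; exact hfafb.symm
      · rw [e4]; exact hfafb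
      · rw [e5 m hm.1 hm.2.1 hm.2.2.1 hm.2.2.2]; exact hfix m
    · intro x y u v hxy hyu huv hxu hyv
      have hyG : y ≠ a ∧ y ≠ b ∧ y ≠ f a ∧ y ≠ f b := by
        refine ⟨?_, ?_, ?_, ?_⟩
        · rintro rfl; rw [e1] at hyv; subst hyv; exact hadj u ⟨hyu, huv⟩
        · rintro rfl; rw [e2] at hyv; subst hyv; omega
        · rintro rfl
          by_cases hx : x = f a
          · rw [hx] at hxy; omega
          · have := hmin x hx; omega
        · rintro rfl; rw [e4] at hyv; subst hyv
          have := hmin (f b) hfafb.symm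
          omega
      have hyv' : f y = v := by rw [← hyv, e5 y hyG.1 hyG.2.1 hyG.2.2.1 hyG.2.2.2]
      rcases cases5 x with rfl | rfl | rfl | rfl | hx
      · rw [e1] at hxu; subst hxu; exact hadj y ⟨hxy, hyu⟩
      · rw [e2] at hxu; subst hxu; omega
      · rw [e3] at hxu; subst hxu
        have := hadj y
        have := i1 _ _ hyG.1
        have := i1 _ _ hyG.2.1
        by_cases hya : ρ y < ρ a
        · exact hf.2.2 (f a) y a v hxy hya (by omega) (hinv a) hyv'
        · exact hf.2.2 b y (f b) v (by omega) hyu huv rfl hyv'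
      · rw [e4] at hxu; subst hxu
        have := hmin (f b) hfafb.symm
        omega
      · rw [e5 x hx.1 hx.2.1 hx.2.2.1 hx.2.2.2] at hxu
        exact hf.2.2 x y u v hxy hyu huv hxu hyv'
  · intro p r hr
    have pa : pt ρ f a = q := by rw [pt, if_neg (by omega)]
    have pb : pt ρ f b = q⁻¹ := by rw [pt, if_pos hfb]
    have hpt : (pt ρ f) ∘ (Equiv.swap a b) = pt ρ f' := by
      funext m
      simp only [Function.comp]
      rcases cases5 m with rfl | rfl | rfl | rfl | hm
      · rw [Equiv.swap_apply_left, pb, pt, e1, if_pos hab]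
      · rw [Equiv.swap_apply_right, pa, pt, e2, if_neg (by omega)]
      · rw [Equiv.swap_apply_of_ne_of_ne (hfix a) hfab, pt, pt, hinv, e3, if_pos ha,
          if_pos (hmin _ hfafb.symm)]
      · have := hmin _ hfafb.symm
        rw [Equiv.swap_apply_of_ne_of_ne hfba (hfix b), pt, pt, hinv, e4, if_neg (by omega),
          if_neg (by omega)]
      · rw [Equiv.swap_apply_of_ne_of_ne hm.1 hm.2.1, pt, pt,
          e5 m hm.1 hm.2.1 hm.2.2.1 hm.2.2.2]
    have h := congrArg (eval (pt ρ f)) hr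
    rw [map_mul, map_sub, map_sub, eval_rename, hpt, eval_X, eval_X, pa, pb] at h
    rw [← h, map_mul, map_sub, map_mul, map_mul, eval_C, eval_C, eval_X, eval_X, pa, pb, q_inv]
    linear_combination (-q * eval (pt ρ f) r) * q_cube


/-- `r` is the divided difference of `p` in the variables `a`, `b`. -/
def IsS {I : Type} (a b : I) (p r : MvPolynomial I ℂ) : Prop :=
  (X b - X a) * r = rename (Equiv.swap a b) p - p

/-- The exchange operator applied to `p`, in terms of the divided difference `r`. -/
noncomputable def SS {I : Type} (a b : I) (r : MvPolynomial I ℂ) : MvPolynomial I ℂ :=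
  (C q * X a - C q⁻¹ * X b) * r

theorem IsS.one {I : Type} {a b : I} (hab : a ≠ b) {p r : MvPolynomial I ℂ} (h : IsS a b p r) :
    eval (fun _ => (1 : ℂ)) r =
      eval (fun _ => (1 : ℂ)) (pderiv a p) - eval (fun _ => (1 : ℂ)) (pderiv b p) := by
  have h2 := congrArg (fun s => eval (fun _ => (1 : ℂ)) (pderiv b s)) h
  have h3 : pderiv b (rename (Equiv.swap a b) p) = rename (Equiv.swap a b) (pderiv a p) := by
    have := pderiv_rename (Equiv.swap a b).injective a p
    rwa [Equiv.swap_apply_left] at this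
  simp only [Derivation.leibniz, map_sub, h3, smul_eq_mul, map_add, map_mul, eval_X, pderiv_X_self,
    pderiv_X_of_ne hab, eval_rename, sub_self, zero_mul, zero_add, sub_zero,
    mul_one] at h2
  exact h2

theorem SS_deg {I : Type} {a b : I} {p r : MvPolynomial I ℂ} {d : ℕ} (hp : p.totalDegree ≤ d)
    (h : r = 0 ∨ r.totalDegree + 1 ≤ p.totalDegree) : (SS a b r).totalDegree ≤ d := by
  rcases h with h | h
  · simp [SS, h]
  · rw [SS]
    refine (totalDegree_mul _ _).trans ?_
    have h1 := totalDegree_sub (C q * X a : MvPolynomial I ℂ) (C q⁻¹ * X b)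
    have h2 := totalDegree_mul (C q) (X a : MvPolynomial I ℂ)
    have h3 := totalDegree_mul (C q⁻¹) (X b : MvPolynomial I ℂ)
    rw [totalDegree_C, totalDegree_X] at h2 h3
    have h4 : max (C q * X a : MvPolynomial I ℂ).totalDegree
      (C q⁻¹ * X b : MvPolynomial I ℂ).totalDegree ≤ 1 := max_le h2 h3
    omega

theorem fsucc_val {m : ℕ} (a : Fin m) :
    (fsucc a).val = if a.val + 1 = m then 0 else a.val + 1 := by
  have := a.2
  simp only [fsucc]
  split_ifs with h
  · rw [h, Nat.mod_self]
  · exact Nat.mod_eq_of_lt (by omega)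

theorem fsucc_ne {m : ℕ} (hm : 2 ≤ m) (a : Fin m) : a ≠ fsucc a := by
  intro h
  have := congrArg Fin.val h
  rw [fsucc_val] at this
  split_ifs at this <;> omega

theorem fsucc_bij (m : ℕ) : Function.Bijective (fsucc : Fin m → Fin m) := by
  rw [← Finite.injective_iff_bijective]
  intro a b h
  have := congrArg Fin.val h
  have := a.2
  have := b.2
  rw [fsucc_val, fsucc_val] at *
  apply Fin.ext
  split_ifs at * <;> omega

theorem rk_fsucc {m c : ℕ} (hc : c < m) (a : Fin m) (h : (fsucc a).val ≠ c) :
    rk m c (fsucc a) = rk m c a + 1 := by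
  have := a.2
  simp only [rk]
  rw [fsucc_val] at *
  split_ifs at * <;> omega

theorem rk_min {m : ℕ} (x k : Fin m) (h : k ≠ x) : rk m x.val x < rk m x.val k := by
  have := x.2
  have h' : k.val ≠ x.val := fun e => h (Fin.ext e)
  simp only [rk]
  split_ifs <;> omega

theorem IsWheel.WH {n : ℕ} {p : MvPolynomial (Fin (2 * n)) ℂ} (h : IsWheel n p) :
    WH (rk (2 * n) 0) p := by
  intro i j k hij hjk z h1 h2
  rw [rk_zero] at hij hjk
  have h3 := congrArg (eval z) (h.2 i j k hij hjk)
  rw [eval_aeval_fun, map_zero] at h3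
  rw [← h3]
  congr 2
  funext l
  split_ifs with a1 a2
  · rw [a1, h1]; simp
  · rw [a2, h2]; simp
  · simp

theorem NCM.isNC {n : ℕ} (σ : NCM n) : IsNC (rk (2 * n) 0) σ.f := by
  rw [rk_zero]
  exact ⟨σ.invol, σ.nofix, fun a b c d h1 h2 h3 => σ.noncross a b c d h1 h2 h3⟩

theorem exists_NCM {n : ℕ} {f : Fin (2 * n) → Fin (2 * n)} (h : IsNC (rk (2 * n) 0) f) :
    ∃ σ : NCM n, σ.f = f := by
  rw [rk_zero] at h
  exact ⟨⟨f, h.1, h.2.1, fun a b c d h1 h2 h3 => h.2.2 a b c d h1 h2 h3⟩, rfl⟩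

theorem evalNC_eq {n : ℕ} (p : MvPolynomial (Fin (2 * n)) ℂ) (σ : NCM n) :
    evalNC p σ = eval (pt (rk (2 * n) 0) σ.f) p := by
  rw [evalNC, rk_zero]
  congr 2

theorem SS_WH {n : ℕ} (hn : 1 ≤ n) (a : Fin (2 * n)) {p r : MvPolynomial (Fin (2 * n)) ℂ}
    (hp : WH (rk (2 * n) 0) p) (h : IsS a (fsucc a) p r) :
    WH (rk (2 * n) 0) (SS a (fsucc a) r) := by
  have h1 := rk_fsucc a.2 a (fun e => fsucc_ne (by omega) a (Fin.ext e.symm))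
  exact (S_WH (rk_inj _ a.val) (by omega) (fun l => by omega) hp.rk h).unrk

theorem step {n : ℕ} (hn : 1 ≤ n) (a : Fin (2 * n)) (σ : NCM n) :
    ∃ τ : NCM n, τ.f = eRaw a σ ∧ ∀ p r : MvPolynomial (Fin (2 * n)) ℂ,
      WH (rk (2 * n) 0) p → p.totalDegree ≤ n * (n - 1) → IsS a (fsucc a) p r →
      (SS a (fsucc a) r).totalDegree ≤ n * (n - 1) →
      evalNC (SS a (fsucc a) r) σ = evalNC p τ - evalNC p σ := by
  have hne : a ≠ fsucc a := fsucc_ne (by omega) a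
  by_cases hab : σ.f a = fsucc a
  · refine ⟨σ, by rw [eRaw, if_pos hab], ?_⟩
    intro p r hp hd h hS
    have h1 := rk_fsucc a.2 a (fun e => hne (Fin.ext e.symm))
    rw [sub_self, evalNC_eq, cut_eval (SS_WH hn a hp h) hS σ.isNC a.val a.2.le]
    exact S_eval_arch (by omega) r σ.isNC.rk hab
  · have h1 := rk_fsucc (σ.f a).2 a (fun e => hab (Fin.ext e.symm))
    have hinv := σ.invol
    have hfix := σ.nofix
    have hfba : σ.f (fsucc a) ≠ a := fun h => hab (by rw [← h, hinv, h])
    have hfafb : σ.f a ≠ σ.f (fsucc a) := fun h => hne (by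
      have := congrArg σ.f h; rwa [hinv, hinv] at this)
    have key := S_eval (rk_inj (2 * n) (σ.f a).val) (a := a) (b := fsucc a) (f := σ.f)
      (f' := eRaw a σ) (by omega) (fun l => by omega) σ.isNC.rk hab (fun k hk => rk_min _ k hk)
      (by rw [eRaw, if_neg hab]; simp)
      (by rw [eRaw, if_neg hab]; simp [hne.symm])
      (by rw [eRaw, if_neg hab]; simp [hfix, hab])
      (by rw [eRaw, if_neg hab]; simp [hfix, hfba, hfafb.symm])
      (by intro m m1 m2 m3 m4; rw [eRaw, if_neg hab]; simp [m1, m2, m3, m4])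
    obtain ⟨τ, hτ⟩ := exists_NCM key.1.unrk
    refine ⟨τ, hτ, ?_⟩
    intro p r hp hd h hS
    have hc := (σ.f a).2.le
    rw [evalNC_eq, evalNC_eq, evalNC_eq, cut_eval (SS_WH hn a hp h) hS σ.isNC _ hc,
      cut_eval hp hd σ.isNC _ hc, cut_eval hp hd τ.isNC _ hc, hτ]
    exact key.2 p r h

theorem psi_stationary (n : ℕ) (hn : 1 ≤ n)
    (Ψ : NCM n → MvPolynomial (Fin (2 * n)) ℂ)
    (hwheel : ∀ π, IsWheel n (Ψ π))
    (hdual : ∀ π σ : NCM n, evalNC (Ψ π) σ = if σ = π then 1 else 0) :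
    Stationary fun π => evalOne (Ψ π) := by
  intro π
  have hW : ∀ σ, WH (rk (2 * n) 0) (Ψ σ) := fun σ => (hwheel σ).WH
  have hD : ∀ σ, (Ψ σ).totalDegree ≤ n * (n - 1) := fun σ => (hwheel σ).1.totalDegree_le
  have main : ∀ a : Fin (2 * n),
      (q - q⁻¹) * (eval (fun _ => (1 : ℂ)) (pderiv a (Ψ π)) -
        eval (fun _ => (1 : ℂ)) (pderiv (fsucc a) (Ψ π))) =
      (∑ σ : NCM n, if eRaw a σ = π.f then evalOne (Ψ σ) else 0) - evalOne (Ψ π) := by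
    intro a
    have hne : a ≠ fsucc a := fsucc_ne (by omega) a
    obtain ⟨r, hr, hrd⟩ := exists_S hne (Ψ π)
    have hS : IsS a (fsucc a) (Ψ π) r := hr
    have hSd := SS_deg (a := a) (b := fsucc a) (hD π) hrd
    have hSW := SS_WH hn a (hW π) hS
    have hzero : SS a (fsucc a) r -
        ((∑ σ : NCM n, if eRaw a σ = π.f then Ψ σ else 0) - Ψ π) = 0 := by
      refine uniq n (Fin (2 * n)) (rk (2 * n) 0) (rk_inj _ _) (by simp) _ ?_ ?_ ?_
      · intro i j k hij hjk z h1 h2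
        rw [map_sub, map_sub, map_sum, hSW i j k hij hjk z h1 h2, hW π i j k hij hjk z h1 h2,
          Finset.sum_eq_zero, sub_zero, sub_zero]
        intro σ _
        split_ifs
        · exact hW σ i j k hij hjk z h1 h2
        · exact map_zero _
      · refine (totalDegree_sub _ _).trans (max_le hSd ?_)
        refine (totalDegree_sub _ _).trans (max_le ?_ (hD π))
        refine (totalDegree_finsetSum _ _).trans (Finset.sup_le ?_)
        intro σ _
        split_ifs
        · exact hD σ
        · simp
      · intro f hf
        obtain ⟨σ, rfl⟩ := exists_NCM hf
        obtain ⟨τ, hτ, hst⟩ := step hn a σ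
        have h1 := hst (Ψ π) r (hW π) (hD π) hS hSd
        rw [hdual, hdual] at h1
        rw [← evalNC_eq]
        have h2 : evalNC (SS a (fsucc a) r -
            ((∑ σ : NCM n, if eRaw a σ = π.f then Ψ σ else 0) - Ψ π)) σ =
            evalNC (SS a (fsucc a) r) σ -
            ((∑ σ' : NCM n, if eRaw a σ' = π.f then evalNC (Ψ σ') σ else 0) -
              evalNC (Ψ π) σ) := by
          simp only [evalNC, map_sub, map_sum]
          congr 2
          refine Finset.sum_congr rfl fun σ' _ => ?_
          split_ifs
          · rfl
          · exact map_zero _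
        rw [h2, h1, hdual]
        have h3 : (∑ σ' : NCM n, if eRaw a σ' = π.f then evalNC (Ψ σ') σ else 0) =
            if τ = π then 1 else 0 := by
          rw [Finset.sum_eq_single σ]
          · rw [hdual, if_pos rfl, ← hτ]
            by_cases h : τ = π
            · rw [if_pos h, if_pos (by rw [h])]
            · rw [if_neg h, if_neg (fun e => h (NCM.ext' e))]
          · intro σ' _ hσ'
            have h0 : evalNC (Ψ σ') σ = 0 := by rw [hdual, if_neg hσ'.symm]
            rw [h0, ite_self]
          · intro h; exact absurd (Finset.mem_univ _) h
        rw [h3, sub_self]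
    have h4 := congrArg (eval (fun _ => (1 : ℂ))) (sub_eq_zero.mp hzero)
    rw [← hS.one hne]
    have h5 : eval (fun _ => (1 : ℂ)) (SS a (fsucc a) r) =
        (q - q⁻¹) * eval (fun _ => (1 : ℂ)) r := by
      simp [SS]
    rw [← h5, h4, map_sub, map_sum]
    congr 1
    refine Finset.sum_congr rfl fun σ _ => ?_
    split_ifs
    · rfl
    · exact map_zero _
  have hsum := Finset.sum_congr (rfl : (Finset.univ : Finset (Fin (2 * n))) = Finset.univ)
    fun a _ => main a
  rw [← Finset.mul_sum, Finset.sum_sub_distrib, Finset.sum_sub_distrib,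
    (fsucc_bij (2 * n)).sum_comp (fun b => eval (fun _ => (1 : ℂ)) (pderiv b (Ψ π))), sub_self,
    mul_zero, Finset.sum_const, Finset.card_univ, Fintype.card_fin, nsmul_eq_mul] at hsum
  exact (sub_eq_zero.mp hsum.symm).symm
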